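/- G satisfies the loop law if and only if for every real z > 0 the characteristic polynomial of A(z) equals the characteristic polynomial of A(1); in particular, under the loop law the multiset of eigenvalues of A(z) (counted with algebraic multiplicity) is independent of z and equals the spectrum of the symmetric 0–1 adjacency matrix A(1) of the underlying graph UG. -/

import Mathlib

open Matrix BigOperators

variable {V : Type*} [Fintype V] [DecidableEq V]

/-- The signed weight `w*`: `w*(u,v) = w(u,v)` if `(u,v)` is an arc, and
`w*(u,v) = -w(v,u)` if `(v,u)` is an arc. -/
def wstar (E : V → V → Prop) [DecidableRel E] (w : V → V → ℝ) (u v : V) : ℝ :=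
  if E u v then w u v else -(w v u)

/-- The polynomial matrix `A(z)`, with `(A(z))_{uv} = z ^ w*(u,v)` (real power)
whenever `(u,v)` or `(v,u)` is an arc, and `0` otherwise. -/
noncomputable def polyMat (E : V → V → Prop) [DecidableRel E]
    (w : V → V → ℝ) (z : ℝ) : Matrix V V ℝ :=
  fun u v => if E u v ∨ E v u then z ^ (wstar E w u v) else 0

/-- Walks of length `r` from `u` to `v` in the underlying graph `UG`. -/
def walks (E : V → V → Prop) [DecidableRel E] (r : ℕ) (u v : V) :
    Finset (Fin (r + 1) → V) :=
  Finset.univ.filter fun p =>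
    p 0 = u ∧ p (Fin.last r) = v ∧
      ∀ i : Fin r, E (p i.castSucc) (p i.succ) ∨ E (p i.succ) (p i.castSucc)

/-- The weight `w*(p)` of a walk `p` of length `r`. -/
def walkWeight (E : V → V → Prop) [DecidableRel E] (w : V → V → ℝ) {r : ℕ}
    (p : Fin (r + 1) → V) : ℝ :=
  ∑ i : Fin r, wstar E w (p i.castSucc) (p i.succ)

/-- The loop law: every closed walk in the underlying graph has weight `0`. -/
def LoopLaw (E : V → V → Prop) [DecidableRel E] (w : V → V → ℝ) : Prop :=
  ∀ (r : ℕ) (p : Fin (r + 1) → V),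
    (∀ i : Fin r, E (p i.castSucc) (p i.succ) ∨ E (p i.succ) (p i.castSucc)) →
    p 0 = p (Fin.last r) → walkWeight E w p = 0

theorem Matrix.det_aeval_eq_of_charpoly_eq {K : Type*} [Field K] [IsAlgClosed K]
    {A B : Matrix V V K} (h : A.charpoly = B.charpoly) (p : Polynomial K) :
    (Polynomial.aeval A p).det = (Polynomial.aeval B p).det := by
  have hlin (t : K) : (Polynomial.aeval A (Polynomial.X - Polynomial.C t)).det =
      (Polynomial.aeval B (Polynomial.X - Polynomial.C t)).det := by
    have hneg (M : Matrix V V K) : Polynomial.aeval M (Polynomial.X - Polynomial.C t) =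
        -(scalar V t - M) := by
      rw [map_sub, Polynomial.aeval_X, Polynomial.aeval_C, neg_sub]
      rfl
    rw [hneg, hneg, det_neg, det_neg, ← eval_charpoly, ← eval_charpoly, h]
  have hp := (IsAlgClosed.splits p).eq_prod_roots
  have hprod (s : Multiset K) :
      (Polynomial.aeval A (s.map fun t => Polynomial.X - Polynomial.C t).prod).det =
        (Polynomial.aeval B (s.map fun t => Polynomial.X - Polynomial.C t).prod).det := by
    induction s using Multiset.induction_on with
    | empty => simp
    | cons t s ih =>
      rw [Multiset.map_cons, Multiset.prod_cons, map_mul, map_mul, det_mul, det_mul, ih, hlin]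
  rw [hp, map_mul, map_mul, det_mul, det_mul, hprod, Polynomial.aeval_C, Polynomial.aeval_C]

theorem Matrix.trace_pow_eq_of_charpoly_eq {K : Type*} [Field K]
    {A B : Matrix V V K} (h : A.charpoly = B.charpoly) (r : ℕ) :
    (A ^ r).trace = (B ^ r).trace := by
  let f := algebraMap K (AlgebraicClosure K)
  have hf : (A.map f).charpoly = (B.map f).charpoly := by
    rw [charpoly_map, charpoly_map, h]
  have hpow : (A.map f ^ r).charpoly = (B.map f ^ r).charpoly := by
    refine Polynomial.funext fun t => ?_
    have haeval (M : Matrix V V (AlgebraicClosure K)) :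
        scalar V t - M ^ r = Polynomial.aeval M (Polynomial.C t - Polynomial.X ^ r) := by
      rw [map_sub, Polynomial.aeval_C, map_pow, Polynomial.aeval_X]
      rfl
    rw [eval_charpoly, eval_charpoly, haeval, haeval, det_aeval_eq_of_charpoly_eq hf]
  apply f.injective
  have htrace := trace_eq_sum_roots_charpoly (A.map f ^ r)
  rw [hpow, ← trace_eq_sum_roots_charpoly, ← Matrix.map_pow, ← Matrix.map_pow] at htrace
  simpa [trace, f] using htrace

section

variable {E : V → V → Prop} [DecidableRel E] {w : V → V → ℝ}

omit [Fintype V] [DecidableEq V] in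
theorem polyMat_apply_of_adj {z : ℝ} {u v : V} (h : E u v ∨ E v u) :
    polyMat E w z u v = z ^ wstar E w u v :=
  if_pos h

omit [Fintype V] [DecidableEq V] in
theorem polyMat_apply_of_not_adj {z : ℝ} {u v : V} (h : ¬(E u v ∨ E v u)) :
    polyMat E w z u v = 0 :=
  if_neg h

omit [Fintype V] [DecidableEq V] in
theorem polyMat_nonneg {z : ℝ} (hz : 0 < z) (u v : V) : 0 ≤ polyMat E w z u v := by
  unfold polyMat
  positivity

omit [Fintype V] [DecidableEq V] in
theorem wstar_swap (honedir : ∀ u v, E u v → ¬E v u) {u v : V} (h : E u v ∨ E v u) :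
    wstar E w v u = -wstar E w u v := by
  rcases h with h | h <;> simp [wstar, h, honedir _ _ h]

omit [Fintype V] [DecidableEq V] in
theorem walkWeight_succ {r : ℕ} (p : Fin (r + 2) → V) :
    walkWeight E w p = walkWeight E w (fun i => p i.castSucc) +
      wstar E w (p (Fin.last r).castSucc) (p (Fin.last (r + 1))) := by
  unfold walkWeight
  rw [Fin.sum_univ_castSucc]
  rfl

theorem rpow_walkWeight_le_pow_polyMat_apply {z : ℝ} (hz : 0 < z) {r : ℕ} (p : Fin (r + 1) → V)
    (hp : ∀ i : Fin r, E (p i.castSucc) (p i.succ) ∨ E (p i.succ) (p i.castSucc)) :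
    z ^ walkWeight E w p ≤ (polyMat E w z ^ r) (p 0) (p (Fin.last r)) := by
  induction r with
  | zero => simp [walkWeight]
  | succ r ih =>
    rw [walkWeight_succ, Real.rpow_add hz, pow_succ, mul_apply]
    have hlast : E (p (Fin.last r).castSucc) (p (Fin.last (r + 1))) ∨
        E (p (Fin.last (r + 1))) (p (Fin.last r).castSucc) := hp (Fin.last r)
    calc _ ≤ (polyMat E w z ^ r) (p 0) (p (Fin.last r).castSucc) *
          polyMat E w z (p (Fin.last r).castSucc) (p (Fin.last (r + 1))) := by
          rw [polyMat_apply_of_adj hlast]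
          exact mul_le_mul_of_nonneg_right
            (ih (fun i => p i.castSucc) fun i => hp i.castSucc) (Real.rpow_nonneg hz.le _)
      _ ≤ _ := Finset.single_le_sum
          (f := fun x => (polyMat E w z ^ r) (p 0) x * polyMat E w z x (p (Fin.last (r + 1))))
          (fun x _ => mul_nonneg (pow_apply_nonneg (polyMat_nonneg hz) r _ _)
            (polyMat_nonneg hz _ _)) (Finset.mem_univ _)

theorem rpow_walkWeight_le_trace_pow_polyMat {z : ℝ} (hz : 0 < z) {r : ℕ} (p : Fin (r + 1) → V)
    (hp : ∀ i : Fin r, E (p i.castSucc) (p i.succ) ∨ E (p i.succ) (p i.castSucc))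
    (hclosed : p 0 = p (Fin.last r)) :
    z ^ walkWeight E w p ≤ (polyMat E w z ^ r).trace := by
  refine (rpow_walkWeight_le_pow_polyMat_apply hz p hp).trans ?_
  rw [← hclosed]
  exact Finset.single_le_sum (f := fun u => (polyMat E w z ^ r) u u)
    (fun u _ => pow_apply_nonneg (polyMat_nonneg hz) r u u) (Finset.mem_univ (p 0))

theorem loopLaw_of_charpoly_eq
    (h : ∀ z : ℝ, 0 < z → (polyMat E w z).charpoly = (polyMat E w 1).charpoly) :
    LoopLaw E w := by
  intro r p hp hclosed
  by_contra hne
  set T := (polyMat E w 1 ^ r).trace with hT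
  have hpos : 0 < |T| + 1 := by positivity
  have hz : 0 < (|T| + 1) ^ (walkWeight E w p)⁻¹ := Real.rpow_pos_of_pos hpos _
  have hle := rpow_walkWeight_le_trace_pow_polyMat (w := w) hz p hp hclosed
  rw [trace_pow_eq_of_charpoly_eq (h _ hz), ← hT, Real.rpow_inv_rpow hpos.le hne] at hle
  linarith [le_abs_self T]

/-- `WalkOfWeight E w u v a` says that the underlying graph has a walk from `u` to `v` of
weight `a`. -/
inductive WalkOfWeight (E : V → V → Prop) [DecidableRel E] (w : V → V → ℝ) (u : V) :
    V → ℝ → Prop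
  | nil : WalkOfWeight E w u u 0
  | snoc {v x : V} {a : ℝ} : WalkOfWeight E w u v a → (E v x ∨ E x v) →
      WalkOfWeight E w u x (a + wstar E w v x)

namespace WalkOfWeight

omit [Fintype V] [DecidableEq V] in
theorem trans {u v x : V} {a b : ℝ} (h₁ : WalkOfWeight E w u v a) (h₂ : WalkOfWeight E w v x b) :
    WalkOfWeight E w u x (a + b) := by
  induction h₂ with
  | nil => simpa using h₁
  | snoc _ hadj ih => rw [← add_assoc]; exact ih.snoc hadj

omit [Fintype V] [DecidableEq V] in
theorem symm (honedir : ∀ u v, E u v → ¬E v u) {u v : V} {a : ℝ} (h : WalkOfWeight E w u v a) :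
    WalkOfWeight E w v u (-a) := by
  induction h with
  | nil => simpa using nil
  | snoc _ hadj ih =>
    have hstep := (nil (E := E) (w := w)).snoc hadj.symm
    rw [wstar_swap honedir hadj] at hstep
    convert hstep.trans ih using 1
    ring

omit [Fintype V] [DecidableEq V] in
theorem exists_walk {u v : V} {a : ℝ} (h : WalkOfWeight E w u v a) :
    ∃ (r : ℕ) (p : Fin (r + 1) → V),
      (∀ i : Fin r, E (p i.castSucc) (p i.succ) ∨ E (p i.succ) (p i.castSucc)) ∧
        p 0 = u ∧ p (Fin.last r) = v ∧ walkWeight E w p = a := by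
  induction h with
  | nil => exact ⟨0, fun _ => u, fun i => i.elim0, rfl, rfl, by simp [walkWeight]⟩
  | @snoc v x a _ hadj ih =>
    obtain ⟨r, p, hp, h0, hlast, hw⟩ := ih
    refine ⟨r + 1, Fin.snoc (α := fun _ => V) p x, fun i => ?_, ?_, ?_, ?_⟩
    · induction i using Fin.lastCases with
      | last => simpa [hlast] using hadj
      | cast i => simpa only [Fin.succ_castSucc, Fin.snoc_castSucc] using hp i
    · rw [← Fin.castSucc_zero, Fin.snoc_castSucc, h0]
    · rw [Fin.snoc_last]
    · rw [walkWeight_succ, Fin.snoc_last]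
      simp only [Fin.snoc_castSucc]
      rw [hw, hlast]

end WalkOfWeight

omit [Fintype V] [DecidableEq V] in
theorem LoopLaw.eq_zero_of_walkOfWeight (h : LoopLaw E w) {u : V} {a : ℝ}
    (hw : WalkOfWeight E w u u a) : a = 0 := by
  obtain ⟨r, p, hp, h0, hlast, rfl⟩ := hw.exists_walk
  exact h r p hp (h0.trans hlast.symm)

omit [Fintype V] [DecidableEq V] in
theorem LoopLaw.exists_potential (honedir : ∀ u v, E u v → ¬E v u) (h : LoopLaw E w) :
    ∃ φ : V → ℝ, ∀ u v, E u v ∨ E v u → wstar E w u v = φ v - φ u := by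
  let S : Setoid V :=
    { r := fun u v => ∃ a, WalkOfWeight E w u v a
      iseqv :=
        { refl := fun _ => ⟨0, .nil⟩
          symm := fun ⟨a, ha⟩ => ⟨-a, ha.symm honedir⟩
          trans := fun ⟨a, ha⟩ ⟨b, hb⟩ => ⟨a + b, ha.trans hb⟩ } }
  choose φ hφ using fun v : V => (Quotient.mk_out (s := S) v : ∃ a, WalkOfWeight E w _ v a)
  refine ⟨φ, fun u v hadj => ?_⟩
  have huv : (Quotient.mk S u) = Quotient.mk S v := Quotient.sound ⟨_, WalkOfWeight.nil.snoc hadj⟩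
  have hu := (hφ u).snoc hadj
  rw [huv] at hu
  linarith [h.eq_zero_of_walkOfWeight (hu.trans ((hφ v).symm honedir))]

theorem LoopLaw.charpoly_polyMat_eq (honedir : ∀ u v, E u v → ¬E v u) (h : LoopLaw E w)
    {z : ℝ} (hz : 0 < z) : (polyMat E w z).charpoly = (polyMat E w 1).charpoly := by
  obtain ⟨φ, hφ⟩ := h.exists_potential honedir
  have hconj : polyMat E w z =
      diagonal (fun v => z ^ (-φ v)) * (polyMat E w 1 * diagonal fun v => z ^ φ v) := by
    ext u v
    rw [diagonal_mul, mul_diagonal]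
    by_cases hadj : E u v ∨ E v u
    · rw [polyMat_apply_of_adj hadj, polyMat_apply_of_adj hadj, Real.one_rpow, one_mul,
        ← Real.rpow_add hz, hφ u v hadj]
      ring_nf
    · simp [polyMat_apply_of_not_adj hadj]
  have hinv : (diagonal fun v => z ^ φ v) * diagonal (fun v => z ^ (-φ v)) = 1 := by
    rw [diagonal_mul_diagonal, ← diagonal_one]
    congr 1
    ext v
    rw [← Real.rpow_add hz, add_neg_cancel, Real.rpow_zero]
  rw [hconj, charpoly_mul_comm, mul_assoc, hinv, mul_one]

end

theorem loopLaw_iff_charpoly (E : V → V → Prop) [DecidableRel E]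
    (w : V → V → ℝ)
    (hloopless : ∀ u, ¬ E u u)
    (honedir : ∀ u v, E u v → ¬ E v u) :
    LoopLaw E w ↔
      ∀ (z : ℝ), 0 < z →
        (polyMat E w z).charpoly = (polyMat E w 1).charpoly := by
  exact ⟨fun h z hz => h.charpoly_polyMat_eq honedir hz, loopLaw_of_charpoly_eq⟩
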